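/- Assume g_θ(x,y) > 0 is bounded above and below as in (A1), that Q_{θ,h,h'} is a coupling of the level-h and level-h' transition densities, and that ν_θ is a coupling of the initial density f_θ with itself. Then for every bounded measurable φ : Θ × X^{n+1} → ℝ: E_{π_{h,h'}}[φ(θ, X_{0:n}) H_{1,θ}(θ, Z_{0:n})] / E_{π_{h,h'}}[H_{1,θ}(θ, Z_{0:n})] = E_{π_h}[φ(θ, X_{0:n})] and E_{π_{h,h'}}[φ(θ, X'_{0:n}) H_{2,θ}(θ, Z_{0:n})] / E_{π_{h,h'}}[H_{2,θ}(θ, Z_{0:n})] = E_{π_{h'}}[φ(θ, X_{0:n})]; consequently E_{π_h}[φ(θ, X_{0:n})] − E_{π_{h'}}[φ(θ, X_{0:n})] equals the difference of the two self-normalized importance-sampling ratios with respect to π_{h,h'}. -/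

import Mathlib

open MeasureTheory Real
open scoped BigOperators ENNReal NNReal

noncomputable section

/-- The parameter space `Θ ⊆ ℝ^{dθ}` (taken as all of `ℝ^{dθ}`). -/
abbrev Theta (dθ : ℕ) := Fin dθ → ℝ
/-- The state space `X = ℝ^d`. -/
abbrev Xsp (d : ℕ) := Fin d → ℝ
/-- The observation space `Y = ℝ^m`. -/
abbrev Ysp (m : ℕ) := Fin m → ℝ
/-- The coupled state space `Z = X × X`. -/
abbrev Zsp (d : ℕ) := Xsp d × Xsp d

/-- `G_{p,θ}(z) = max (g_θ(x, y_p), g_θ(x', y_p))` for `z = (x,x')`,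
indexed by `p : Fin n` corresponding to the observation `y_{p+1}`. -/
def Gmax {dθ d m n : ℕ} (g : Theta dθ → Xsp d → Ysp m → ℝ) (y : Fin n → Ysp m)
    (θ : Theta dθ) (p : Fin n) (z : Zsp d) : ℝ :=
  max (g θ z.1 (y p)) (g θ z.2 (y p))

/-- The importance weight `H_{1,θ}(θ, z_{0:n}) = ∏_{p=1}^n g_θ(x_p, y_p) / G_{p,θ}(z_p)`. -/
def H1 {dθ d m n : ℕ} (g : Theta dθ → Xsp d → Ysp m → ℝ) (y : Fin n → Ysp m)
    (θ : Theta dθ) (z : Fin (n + 1) → Zsp d) : ℝ :=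
  ∏ p : Fin n, g θ (z p.succ).1 (y p) / Gmax g y θ p (z p.succ)

/-- The importance weight `H_{2,θ}(θ, z_{0:n}) = ∏_{p=1}^n g_θ(x'_p, y_p) / G_{p,θ}(z_p)`. -/
def H2 {dθ d m n : ℕ} (g : Theta dθ → Xsp d → Ysp m → ℝ) (y : Fin n → Ysp m)
    (θ : Theta dθ) (z : Fin (n + 1) → Zsp d) : ℝ :=
  ∏ p : Fin n, g θ (z p.succ).2 (y p) / Gmax g y θ p (z p.succ)

/-- The unnormalized density of the coupled target
`π_{h,h'}(θ, z_{0:n}) ∝ π_θ(θ) ν_θ(z_0) ∏_{p=1}^n G_{p,θ}(z_p) Q_{θ,h,h'}(z_{p-1}, z_p)`,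
where `Q` is already specialized at the pair of discretization levels `(h, h')`. -/
def densC {dθ d m n : ℕ} (g : Theta dθ → Xsp d → Ysp m → ℝ) (y : Fin n → Ysp m)
    (πθ : Theta dθ → ℝ) (ν : Theta dθ → Zsp d → ℝ) (Q : Theta dθ → Zsp d → Zsp d → ℝ)
    (v : Theta dθ × (Fin (n + 1) → Zsp d)) : ℝ :=
  πθ v.1 * ν v.1 (v.2 0) *
    ∏ p : Fin n, Gmax g y v.1 p (v.2 p.succ) * Q v.1 (v.2 p.castSucc) (v.2 p.succ)

/-- Normalizing constant of the coupled target. -/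
def Znorm {dθ d m n : ℕ} (g : Theta dθ → Xsp d → Ysp m → ℝ) (y : Fin n → Ysp m)
    (πθ : Theta dθ → ℝ) (ν : Theta dθ → Zsp d → ℝ) (Q : Theta dθ → Zsp d → Zsp d → ℝ) : ℝ :=
  ∫ v : Theta dθ × (Fin (n + 1) → Zsp d), densC g y πθ ν Q v

/-- The coupled target probability measure `π_{h,h'}` on `Θ × Z^{n+1}`. -/
def piCoup {dθ d m n : ℕ} (g : Theta dθ → Xsp d → Ysp m → ℝ) (y : Fin n → Ysp m)
    (πθ : Theta dθ → ℝ) (ν : Theta dθ → Zsp d → ℝ) (Q : Theta dθ → Zsp d → Zsp d → ℝ) :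
    Measure (Theta dθ × (Fin (n + 1) → Zsp d)) :=
  volume.withDensity fun v => ENNReal.ofReal (densC g y πθ ν Q v / Znorm g y πθ ν Q)

/-- Assumption (A1): the observation density is bounded above and below, uniformly in
`(θ, x)`, and globally Lipschitz in `(θ, x)`, for each fixed observation `y`. -/
def AssumptionA1 {dθ d m : ℕ} (g : Theta dθ → Xsp d → Ysp m → ℝ) : Prop :=
  ∀ yv : Ysp m,
    (∃ Clo Chi : ℝ, 0 < Clo ∧ Clo ≤ Chi ∧
      ∀ (θ : Theta dθ) (x : Xsp d), Clo ≤ g θ x yv ∧ g θ x yv ≤ Chi) ∧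
    ∃ L : ℝ≥0, LipschitzWith L fun p : Xsp d × Theta dθ => g p.2 p.1 yv

/-- Assumption (A2): for every `0 ≤ k ≤ n` and `q ∈ {1,2}` there is a rate `β > 0` such
that for every bounded Lipschitz measurable `φ` there is `C < ∞`, independent of the
discretization levels `0 < h < h'`, with
`(∫ |φ(θ,x_{0:k}) - φ(θ,x'_{0:k})|^q ∏_{p=1}^k Q_{θ,h,h'}(z_{p-1},z_p) π_θ(θ) ν_θ(z_0))^{3-q}
  ≤ C (h')^β`. -/
def AssumptionA2 {dθ d : ℕ} (n : ℕ) (πθ : Theta dθ → ℝ) (ν : Theta dθ → Zsp d → ℝ)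
    (Q : ℝ → ℝ → Theta dθ → Zsp d → Zsp d → ℝ) : Prop :=
  ∀ k : ℕ, k ≤ n → ∀ q : ℕ, q = 1 ∨ q = 2 →
    ∃ β : ℝ, 0 < β ∧
      ∀ φ : Theta dθ × (Fin (k + 1) → Xsp d) → ℝ,
        Measurable φ → (∃ B : ℝ, ∀ u, |φ u| ≤ B) → (∃ L : ℝ≥0, LipschitzWith L φ) →
        ∃ C : ℝ, ∀ h h' : ℝ, 0 < h → h < h' →
          (∫ w : Theta dθ × (Fin (k + 1) → Zsp d),
              |φ (w.1, fun i => (w.2 i).1) - φ (w.1, fun i => (w.2 i).2)| ^ q *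
                ((∏ p : Fin k, Q h h' w.1 (w.2 p.castSucc) (w.2 p.succ)) *
                  (πθ w.1 * ν w.1 (w.2 0)))) ^ (3 - q)
            ≤ C * h' ^ β


/-- The unnormalized density of the single-level posterior
`π_h(θ, x_{0:n}) ∝ π_θ(θ) f_θ(x_0) ∏_{p=1}^n g_θ(x_p, y_p) f_{θ,h}(x_{p-1}, x_p)`,
where `ftrans` is the level-`h` transition density and `f0` the initial density. -/
def densS {dθ d m n : ℕ} (g : Theta dθ → Xsp d → Ysp m → ℝ) (y : Fin n → Ysp m)
    (πθ : Theta dθ → ℝ) (f0 : Theta dθ → Xsp d → ℝ) (ftrans : Theta dθ → Xsp d → Xsp d → ℝ)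
    (u : Theta dθ × (Fin (n + 1) → Xsp d)) : ℝ :=
  πθ u.1 * f0 u.1 (u.2 0) *
    ∏ p : Fin n, g u.1 (u.2 p.succ) (y p) * ftrans u.1 (u.2 p.castSucc) (u.2 p.succ)

/-- The single-level posterior probability measure `π_h` on `Θ × X^{n+1}`. -/
def piSingle {dθ d m n : ℕ} (g : Theta dθ → Xsp d → Ysp m → ℝ) (y : Fin n → Ysp m)
    (πθ : Theta dθ → ℝ) (f0 : Theta dθ → Xsp d → ℝ)
    (ftrans : Theta dθ → Xsp d → Xsp d → ℝ) :
    Measure (Theta dθ × (Fin (n + 1) → Xsp d)) :=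
  volume.withDensity fun u =>
    ENNReal.ofReal (densS g y πθ f0 ftrans u /
      ∫ u' : Theta dθ × (Fin (n + 1) → Xsp d), densS g y πθ f0 ftrans u')

/-- Iterated-integral form of integration over `Fin (k + 1) → α`, last coordinate innermost. -/
lemma lintegral_pi_snoc {α : Type*} [MeasurableSpace α] (μ : Measure α) [SigmaFinite μ]
    {k : ℕ} (F : (Fin (k + 1) → α) → ℝ≥0∞) (hF : Measurable F) :
    ∫⁻ z, F z ∂Measure.pi (fun _ => μ) =
      ∫⁻ z : Fin k → α, ∫⁻ a, F (Fin.snoc z a) ∂μ ∂Measure.pi (fun _ => μ) := by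
  have e := (measurePreserving_piFinSuccAbove (fun _ : Fin (k + 1) => μ) (Fin.last k)).symm
  have hFe := hF.comp e.measurable
  rw [← e.lintegral_comp hF]
  refine (lintegral_prod_symm' _ hFe).trans ?_
  refine lintegral_congr fun z => lintegral_congr fun a => ?_
  exact congrArg F (Fin.insertNth_last (α := fun _ => α) a z)

lemma measurable_snoc {α : Type*} [MeasurableSpace α] {k : ℕ} :
    Measurable fun p : (Fin k → α) × α => (Fin.snoc p.1 p.2 : Fin (k + 1) → α) := by
  refine measurable_pi_lambda _ fun i => ?_
  refine Fin.lastCases ?_ (fun j => ?_) i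
  · simpa using measurable_snd
  · simp only [Fin.snoc_castSucc]
    exact (measurable_pi_apply j).comp measurable_fst

lemma snoc_zero {A : Type*} (z : Fin 0 → A) (a : A) :
    (Fin.snoc z a : Fin (0 + 1) → A) = fun _ => a := by
  funext i
  obtain rfl : i = Fin.last 0 := Fin.fin_one_eq_zero i
  exact Fin.snoc_last (α := fun _ => A) a z

/-- The path density of a Markov chain with initial density `w` and transition density `t`. -/
def chainDens {A R : Type*} [CommMonoid R] {k : ℕ} (w : A → R) (t : A → A → R)
    (z : Fin (k + 1) → A) : R :=
  w (z 0) * ∏ p : Fin k, t (z p.castSucc) (z p.succ)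

lemma chainDens_snoc {A R : Type*} [CommMonoid R] {k : ℕ} (w : A → R) (t : A → A → R)
    (z : Fin (k + 1) → A) (a : A) :
    chainDens w t (Fin.snoc z a : Fin (k + 2) → A) = chainDens w t z * t (z (Fin.last k)) a := by
  have h0 : (Fin.snoc z a : Fin (k + 2) → A) 0 = z 0 := by
    rw [← Fin.castSucc_zero]; exact Fin.snoc_castSucc (α := fun _ => A) a z 0
  simp only [chainDens, Fin.prod_univ_castSucc, h0, Fin.snoc_castSucc, Fin.succ_castSucc,
    Fin.succ_last, Fin.snoc_last, mul_assoc]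

lemma measurable_chainDens {A : Type*} [MeasurableSpace A] {k : ℕ} {w : A → ℝ≥0∞}
    {t : A → A → ℝ≥0∞} (hw : Measurable w) (ht : Measurable fun p : A × A => t p.1 p.2) :
    Measurable (chainDens (k := k) w t) := by
  refine (hw.comp (measurable_pi_apply _)).mul (Finset.measurable_prod _ fun p _ => ?_)
  have hp : Measurable fun z : Fin (k + 1) → A => (z p.castSucc, z p.succ) := by fun_prop
  exact ht.comp hp

/-- If `pr` maps a Markov chain with initial density `ν` and transition density `q` to one with
initial density `f₀` and transition density `f` one step at a time, it does so for paths. -/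
lemma lintegral_chainDens_proj {Z X : Type*} [MeasurableSpace Z] [MeasurableSpace X]
    (μ : Measure Z) [SigmaFinite μ] (ρ : Measure X) [SigmaFinite ρ]
    {pr : Z → X} (hpr : Measurable pr)
    {ν : Z → ℝ≥0∞} {f₀ : X → ℝ≥0∞} {q : Z → Z → ℝ≥0∞} {f : X → X → ℝ≥0∞}
    (hν : Measurable ν) (hf₀ : Measurable f₀)
    (hq : Measurable fun p : Z × Z => q p.1 p.2) (hf : Measurable fun p : X × X => f p.1 p.2)
    (hinit : ∀ ψ : X → ℝ≥0∞, Measurable ψ →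
      ∫⁻ z, ψ (pr z) * ν z ∂μ = ∫⁻ x, ψ x * f₀ x ∂ρ)
    (hstep : ∀ ψ : X → ℝ≥0∞, Measurable ψ → ∀ z,
      ∫⁻ z', ψ (pr z') * q z z' ∂μ = ∫⁻ x, ψ x * f (pr z) x ∂ρ)
    (k : ℕ) (Ψ : (Fin (k + 1) → X) → ℝ≥0∞) (hΨ : Measurable Ψ) :
    ∫⁻ z : Fin (k + 1) → Z, Ψ (fun i => pr (z i)) * chainDens ν q z ∂Measure.pi (fun _ => μ) =
      ∫⁻ x : Fin (k + 1) → X, Ψ x * chainDens f₀ f x ∂Measure.pi (fun _ => ρ) := by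
  have hprk : ∀ k : ℕ, Measurable fun (z : Fin (k + 1) → Z) i => pr (z i) := fun k =>
    measurable_pi_lambda _ fun i => hpr.comp (measurable_pi_apply i)
  have hmL : ∀ (k : ℕ) (Ψ : (Fin (k + 1) → X) → ℝ≥0∞), Measurable Ψ → Measurable
      fun z : Fin (k + 1) → Z => Ψ (fun i => pr (z i)) * chainDens ν q z := fun k Ψ hΨ =>
    (hΨ.comp (hprk k)).mul (measurable_chainDens hν hq)
  have hmR : ∀ (k : ℕ) (Ψ : (Fin (k + 1) → X) → ℝ≥0∞), Measurable Ψ → Measurable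
      fun x : Fin (k + 1) → X => Ψ x * chainDens f₀ f x := fun k Ψ hΨ =>
    hΨ.mul (measurable_chainDens hf₀ hf)
  induction k with
  | zero =>
    rw [lintegral_pi_snoc _ _ (hmL _ Ψ hΨ),
      lintegral_pi_snoc _ _ (hmR _ Ψ hΨ)]
    have hm : Measurable fun x : X => Ψ (fun _ => x) :=
      hΨ.comp (measurable_pi_lambda _ fun _ => measurable_id)
    have key := hinit _ hm
    rw [Measure.pi_of_empty, Measure.pi_of_empty]
    simp only [snoc_zero, chainDens, Finset.univ_eq_empty, Finset.prod_empty, mul_one]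
    simpa using key
  | succ k ih =>
    rw [lintegral_pi_snoc _ _ (hmL _ Ψ hΨ),
      lintegral_pi_snoc _ _ (hmR _ Ψ hΨ)]
    have hpush : ∀ (z : Fin (k + 1) → Z) (a : Z),
        (fun i => pr ((Fin.snoc z a : Fin (k + 2) → Z) i)) =
          (Fin.snoc (fun i => pr (z i)) (pr a) : Fin (k + 2) → X) := fun z a =>
      Fin.comp_snoc pr z a
    have hΨ' : ∀ x : Fin (k + 1) → X, Measurable fun a : X => Ψ (Fin.snoc x a) := fun x =>
      hΨ.comp (measurable_snoc.comp measurable_prodMk_left)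
    have hΦ : Measurable fun x : Fin (k + 1) → X =>
        ∫⁻ a, Ψ (Fin.snoc x a) * f (x (Fin.last k)) a ∂ρ := by
      refine Measurable.lintegral_prod_right' (f := fun p : (Fin (k + 1) → X) × X =>
        Ψ (Fin.snoc p.1 p.2) * f (p.1 (Fin.last k)) p.2) ?_
      refine (hΨ.comp measurable_snoc).mul ?_
      have hp : Measurable fun p : (Fin (k + 1) → X) × X => (p.1 (Fin.last k), p.2) := by fun_prop
      exact hf.comp hp
    have hL : ∀ z : Fin (k + 1) → Z,
        ∫⁻ a, Ψ (fun i => pr ((Fin.snoc z a : Fin (k + 2) → Z) i)) *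
          chainDens ν q (Fin.snoc z a : Fin (k + 2) → Z) ∂μ =
        (∫⁻ a, Ψ (Fin.snoc (fun i => pr (z i)) a) * f (pr (z (Fin.last k))) a ∂ρ) *
          chainDens ν q z := by
      intro z
      rw [← hstep _ (hΨ' _), ← lintegral_mul_const]
      · refine lintegral_congr fun a => ?_
        rw [hpush, chainDens_snoc]
        ring
      · refine ((hΨ' _).comp hpr).mul ?_
        exact hq.comp (g := fun p : Z × Z => q p.1 p.2) measurable_prodMk_left
    have hR : ∀ x : Fin (k + 1) → X,
        ∫⁻ a, Ψ (Fin.snoc x a) * chainDens f₀ f (Fin.snoc x a : Fin (k + 2) → X) ∂ρ =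
        (∫⁻ a, Ψ (Fin.snoc x a) * f (x (Fin.last k)) a ∂ρ) * chainDens f₀ f x := by
      intro x
      rw [← lintegral_mul_const]
      · refine lintegral_congr fun a => ?_
        rw [chainDens_snoc]
        ring
      · refine (hΨ' _).mul ?_
        exact hf.comp (g := fun p : X × X => f p.1 p.2) measurable_prodMk_left
    simp only [hL, hR]
    exact ih _ hΦ

lemma lintegral_fst_mul_ofReal {X Y : Type*} [MeasurableSpace X] [MeasurableSpace Y]
    (μ : Measure X) [SigmaFinite μ] (ρ : Measure Y) [SigmaFinite ρ]
    {r : X × Y → ℝ} {s : X → ℝ} (hr : Measurable r) (hr0 : ∀ z, 0 ≤ r z)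
    (hri : Integrable r (μ.prod ρ)) (hs : ∀ x, ∫ x', r (x, x') ∂ρ = s x)
    (ψ : X → ℝ≥0∞) (hψ : Measurable ψ) :
    ∫⁻ z, ψ z.1 * ENNReal.ofReal (r z) ∂μ.prod ρ = ∫⁻ x, ψ x * ENNReal.ofReal (s x) ∂μ := by
  have hm : Measurable fun z : X × Y => ψ z.1 * ENNReal.ofReal (r z) :=
    (hψ.comp measurable_fst).mul hr.ennreal_ofReal
  rw [lintegral_prod _ hm.aemeasurable]
  refine lintegral_congr_ae ?_
  filter_upwards [hri.prod_right_ae] with x hx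
  have hrx : Measurable fun x' => r (x, x') := hr.comp measurable_prodMk_left
  rw [lintegral_const_mul _ hrx.ennreal_ofReal, ← hs,
    ofReal_integral_eq_lintegral_ofReal hx (ae_of_all _ fun _ => hr0 _)]

lemma lintegral_snd_mul_ofReal {X Y : Type*} [MeasurableSpace X] [MeasurableSpace Y]
    (μ : Measure X) [SigmaFinite μ] (ρ : Measure Y) [SigmaFinite ρ]
    {r : X × Y → ℝ} {s : Y → ℝ} (hr : Measurable r) (hr0 : ∀ z, 0 ≤ r z)
    (hri : Integrable r (μ.prod ρ)) (hs : ∀ x', ∫ x, r (x, x') ∂μ = s x')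
    (ψ : Y → ℝ≥0∞) (hψ : Measurable ψ) :
    ∫⁻ z, ψ z.2 * ENNReal.ofReal (r z) ∂μ.prod ρ = ∫⁻ x, ψ x * ENNReal.ofReal (s x) ∂ρ := by
  rw [← lintegral_fst_mul_ofReal ρ μ (hr.comp measurable_swap) (fun z => hr0 _) hri.swap hs ψ hψ]
  exact (lintegral_prod_swap fun z : X × Y => ψ z.2 * ENNReal.ofReal (r z)).symm

/-- Measurability, positivity and normalization of the coupled model, with no condition on the
marginals of the transition density `Q`. -/
structure IsCoupledModel {dθ d m n : ℕ} (g : Theta dθ → Xsp d → Ysp m → ℝ) (y : Fin n → Ysp m)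
    (πθ : Theta dθ → ℝ) (ν : Theta dθ → Zsp d → ℝ) (Q : Theta dθ → Zsp d → Zsp d → ℝ) :
    Prop where
  measurable_g : ∀ p, Measurable fun u : Theta dθ × Xsp d => g u.1 u.2 (y p)
  g_bounds : ∀ p, ∃ Clo Chi : ℝ, 0 < Clo ∧ Clo ≤ Chi ∧
    ∀ (θ : Theta dθ) (x : Xsp d), Clo ≤ g θ x (y p) ∧ g θ x (y p) ≤ Chi
  measurable_prior : Measurable πθ
  prior_nonneg : ∀ θ, 0 ≤ πθ θ
  integral_prior : ∫ θ, πθ θ = 1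
  measurable_init : Measurable fun p : Theta dθ × Zsp d => ν p.1 p.2
  init_nonneg : ∀ θ z, 0 ≤ ν θ z
  integral_init : ∀ θ, ∫ z, ν θ z = 1
  measurable_trans : Measurable fun p : Theta dθ × Zsp d × Zsp d => Q p.1 p.2.1 p.2.2
  trans_nonneg : ∀ θ z z', 0 ≤ Q θ z z'
  integral_trans : ∀ θ z, ∫ z', Q θ z z' = 1

/-- `pr : X × X → X` sends the coupled initial and transition densities to `f₀` and `f`. -/
structure IsMarginal {dθ d : ℕ} (pr : Zsp d → Xsp d) (ν : Theta dθ → Zsp d → ℝ)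
    (Q : Theta dθ → Zsp d → Zsp d → ℝ) (f₀ : Theta dθ → Xsp d → ℝ)
    (f : Theta dθ → Xsp d → Xsp d → ℝ) : Prop where
  measurable_pr : Measurable pr
  measurable_init : Measurable fun p : Theta dθ × Xsp d => f₀ p.1 p.2
  init_nonneg : ∀ θ x, 0 ≤ f₀ θ x
  measurable_trans : Measurable fun p : Theta dθ × Xsp d × Xsp d => f p.1 p.2.1 p.2.2
  trans_nonneg : ∀ θ x x', 0 ≤ f θ x x'
  lintegral_init : ∀ θ (ψ : Xsp d → ℝ≥0∞), Measurable ψ →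
    ∫⁻ z, ψ (pr z) * ENNReal.ofReal (ν θ z) = ∫⁻ x, ψ x * ENNReal.ofReal (f₀ θ x)
  lintegral_trans : ∀ θ (ψ : Xsp d → ℝ≥0∞), Measurable ψ → ∀ z,
    ∫⁻ z', ψ (pr z') * ENNReal.ofReal (Q θ z z') = ∫⁻ x, ψ x * ENNReal.ofReal (f θ (pr z) x)

/-- The path density with observation densities `γ p` (a real density on an arbitrary state
space, subsuming both the coupled and the single-level targets). -/
def pathDens {T A : Type*} {n : ℕ} (γ : Fin n → T → A → ℝ) (r : T → ℝ) (w : T → A → ℝ)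
    (t : T → A → A → ℝ) (v : T × (Fin (n + 1) → A)) : ℝ :=
  r v.1 * w v.1 (v.2 0) * ∏ p : Fin n, γ p v.1 (v.2 p.succ) * t v.1 (v.2 p.castSucc) (v.2 p.succ)

section pathDens

variable {T A : Type*} {n : ℕ} {γ : Fin n → T → A → ℝ}
  {r : T → ℝ} {w : T → A → ℝ} {t : T → A → A → ℝ}

lemma pathDens_nonneg (hγ : ∀ p θ x, 0 ≤ γ p θ x) (hπ : ∀ θ, 0 ≤ r θ)
    (hw : ∀ θ x, 0 ≤ w θ x) (ht : ∀ θ x x', 0 ≤ t θ x x') (v : T × (Fin (n + 1) → A)) :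
    0 ≤ pathDens γ r w t v :=
  mul_nonneg (mul_nonneg (hπ _) (hw _ _))
    (Finset.prod_nonneg fun _ _ => mul_nonneg (hγ _ _ _) (ht _ _ _))

lemma ofReal_pathDens (hγ : ∀ p θ x, 0 ≤ γ p θ x) (hπ : ∀ θ, 0 ≤ r θ)
    (hw : ∀ θ x, 0 ≤ w θ x) (ht : ∀ θ x x', 0 ≤ t θ x x') (θ : T) (z : Fin (n + 1) → A) :
    ENNReal.ofReal (pathDens γ r w t (θ, z)) =
      ENNReal.ofReal (r θ) * (∏ p : Fin n, ENNReal.ofReal (γ p θ (z p.succ))) *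
        chainDens (fun a => ENNReal.ofReal (w θ a)) (fun a b => ENNReal.ofReal (t θ a b)) z := by
  simp only [pathDens, chainDens]
  rw [ENNReal.ofReal_mul (mul_nonneg (hπ _) (hw _ _)), ENNReal.ofReal_mul (hπ _),
    ENNReal.ofReal_prod_of_nonneg fun p _ => mul_nonneg (hγ _ _ _) (ht _ _ _)]
  simp only [fun p => ENNReal.ofReal_mul (hγ p θ (z p.succ)) (q := t θ (z p.castSucc) (z p.succ)),
    Finset.prod_mul_distrib]
  ring

lemma measurable_pathDens [MeasurableSpace T] [MeasurableSpace A]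
    (hγ : ∀ p, Measurable fun u : T × A => γ p u.1 u.2)
    (hπ : Measurable r) (hw : Measurable fun u : T × A => w u.1 u.2)
    (ht : Measurable fun u : T × A × A => t u.1 u.2.1 u.2.2) :
    Measurable (pathDens γ r w t) := by
  have h1 : Measurable fun v : T × (Fin (n + 1) → A) => (v.1, v.2 0) := by fun_prop
  refine ((hπ.comp measurable_fst).mul (hw.comp h1)).mul
    (Finset.measurable_prod _ fun p _ => ?_)
  have h2 : Measurable fun v : T × (Fin (n + 1) → A) => (v.1, v.2 p.succ) := by fun_prop
  have h3 : Measurable fun v : T × (Fin (n + 1) → A) => (v.1, v.2 p.castSucc, v.2 p.succ) := by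
    fun_prop
  exact ((hγ p).comp h2).mul (ht.comp h3)

end pathDens

section Model

variable {dθ d m n : ℕ} {g : Theta dθ → Xsp d → Ysp m → ℝ} {y : Fin n → Ysp m}
  {πθ : Theta dθ → ℝ} {ν : Theta dθ → Zsp d → ℝ} {Q : Theta dθ → Zsp d → Zsp d → ℝ}
  {pr : Zsp d → Xsp d} {f₀ : Theta dθ → Xsp d → ℝ} {f : Theta dθ → Xsp d → Xsp d → ℝ}

lemma IsCoupledModel.g_pos (hM : IsCoupledModel g y πθ ν Q) (p : Fin n) (θ : Theta dθ)
    (x : Xsp d) : 0 < g θ x (y p) := by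
  obtain ⟨Clo, Chi, h0, -, h⟩ := hM.g_bounds p
  exact h0.trans_le (h θ x).1

lemma measurable_uncurry_of_param {T A B : Type*} [MeasurableSpace T] [MeasurableSpace A]
    [MeasurableSpace B] {t : T → A → B → ℝ}
    (ht : Measurable fun u : T × A × B => t u.1 u.2.1 u.2.2) (θ : T) :
    Measurable fun u : A × B => ENNReal.ofReal (t θ u.1 u.2) :=
  (ht.comp (measurable_prodMk_left (x := θ))).ennreal_ofReal

lemma measurable_of_param {T A : Type*} [MeasurableSpace T] [MeasurableSpace A] {w : T → A → ℝ}
    (hw : Measurable fun u : T × A => w u.1 u.2) (θ : T) :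
    Measurable fun u : A => ENNReal.ofReal (w θ u) :=
  (hw.comp (measurable_prodMk_left (x := θ))).ennreal_ofReal

/-- The target on coupled paths whose observation densities are evaluated along `pr`. -/
def projDens (g : Theta dθ → Xsp d → Ysp m → ℝ) (y : Fin n → Ysp m) (πθ : Theta dθ → ℝ)
    (ν : Theta dθ → Zsp d → ℝ) (Q : Theta dθ → Zsp d → Zsp d → ℝ) (pr : Zsp d → Xsp d) :
    Theta dθ × (Fin (n + 1) → Zsp d) → ℝ :=
  pathDens (fun p θ z => g θ (pr z) (y p)) πθ ν Q

lemma densS_eq_pathDens :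
    densS g y πθ f₀ f = pathDens (fun p θ x => g θ x (y p)) πθ f₀ f := rfl

lemma measurable_projDens (hM : IsCoupledModel g y πθ ν Q) (hpr : Measurable pr) :
    Measurable (projDens g y πθ ν Q pr) := by
  refine measurable_pathDens (fun p => ?_) hM.measurable_prior hM.measurable_init
    hM.measurable_trans
  have h : Measurable fun u : Theta dθ × Zsp d => (u.1, pr u.2) := by fun_prop
  exact (hM.measurable_g p).comp h

lemma measurable_densS (hM : IsCoupledModel g y πθ ν Q) (hP : IsMarginal pr ν Q f₀ f) :
    Measurable (densS g y πθ f₀ f) :=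
  measurable_pathDens (γ := fun p θ x => g θ x (y p)) hM.measurable_g hM.measurable_prior
    hP.measurable_init hP.measurable_trans

lemma measurable_densC (hM : IsCoupledModel g y πθ ν Q) : Measurable (densC g y πθ ν Q) := by
  refine measurable_pathDens (γ := fun p θ z => Gmax g y θ p z) (fun p => ?_)
    hM.measurable_prior hM.measurable_init hM.measurable_trans
  have h1 : Measurable fun u : Theta dθ × Zsp d => (u.1, u.2.1) := by fun_prop
  have h2 : Measurable fun u : Theta dθ × Zsp d => (u.1, u.2.2) := by fun_prop
  exact ((hM.measurable_g p).comp h1).max ((hM.measurable_g p).comp h2)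

lemma measurable_projPath (hpr : Measurable pr) : Measurable
    fun v : Theta dθ × (Fin (n + 1) → Zsp d) => (v.1, fun i => pr (v.2 i)) := by
  fun_prop

lemma lintegral_projDens (hM : IsCoupledModel g y πθ ν Q) (hP : IsMarginal pr ν Q f₀ f)
    (F : Theta dθ × (Fin (n + 1) → Xsp d) → ℝ≥0∞) (hF : Measurable F) :
    ∫⁻ v, F (v.1, fun i => pr (v.2 i)) * ENNReal.ofReal (projDens g y πθ ν Q pr v) =
      ∫⁻ u, F u * ENNReal.ofReal (densS g y πθ f₀ f u) := by
  have hmL : Measurable fun v : Theta dθ × (Fin (n + 1) → Zsp d) =>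
      F (v.1, fun i => pr (v.2 i)) * ENNReal.ofReal (projDens g y πθ ν Q pr v) :=
    (hF.comp (measurable_projPath hP.measurable_pr)).mul
      (measurable_projDens hM hP.measurable_pr).ennreal_ofReal
  have hmR : Measurable fun u => F u * ENNReal.ofReal (densS g y πθ f₀ f u) :=
    hF.mul (measurable_densS hM hP).ennreal_ofReal
  rw [Measure.volume_eq_prod, lintegral_prod _ hmL.aemeasurable, Measure.volume_eq_prod,
    lintegral_prod _ hmR.aemeasurable]
  refine lintegral_congr fun θ => ?_
  have hΨ : Measurable fun x : Fin (n + 1) → Xsp d => F (θ, x) *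
      (ENNReal.ofReal (πθ θ) * ∏ p : Fin n, ENNReal.ofReal (g θ (x p.succ) (y p))) := by
    refine (hF.comp measurable_prodMk_left).mul
      (measurable_const.mul (Finset.measurable_prod _ fun p _ => ?_))
    have h : Measurable fun x : Fin (n + 1) → Xsp d => (θ, x p.succ) := by fun_prop
    exact ((hM.measurable_g p).comp h).ennreal_ofReal
  have key := lintegral_chainDens_proj volume volume hP.measurable_pr
    (q := fun a b => ENNReal.ofReal (Q θ a b)) (f := fun a b => ENNReal.ofReal (f θ a b))
    (measurable_of_param hM.measurable_init θ) (measurable_of_param hP.measurable_init θ)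
    (measurable_uncurry_of_param hM.measurable_trans θ)
    (measurable_uncurry_of_param hP.measurable_trans θ)
    (hP.lintegral_init θ) (hP.lintegral_trans θ) n _ hΨ
  simp only [projDens, densS_eq_pathDens]
  simp only [ofReal_pathDens (fun p θ (x : Xsp d) => (hM.g_pos p θ x).le) hM.prior_nonneg
      hP.init_nonneg hP.trans_nonneg,
    ofReal_pathDens (fun p θ (z : Zsp d) => (hM.g_pos p θ (pr z)).le) hM.prior_nonneg
      hM.init_nonneg hM.trans_nonneg, ← mul_assoc] at key ⊢
  exact key

lemma integral_projDens (hM : IsCoupledModel g y πθ ν Q) (hP : IsMarginal pr ν Q f₀ f)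
    {φ : Theta dθ × (Fin (n + 1) → Xsp d) → ℝ} (hφ : Measurable φ) :
    ∫ v, φ (v.1, fun i => pr (v.2 i)) * projDens g y πθ ν Q pr v =
      ∫ u, φ u * densS g y πθ f₀ f u := by
  have hmL := (measurable_projDens hM hP.measurable_pr).ennreal_ofReal
  have hmR := (measurable_densS hM hP).ennreal_ofReal
  have hmP := measurable_projPath (dθ := dθ) (n := n) hP.measurable_pr
  have hmap : Measure.map
      (fun v : Theta dθ × (Fin (n + 1) → Zsp d) => (v.1, fun i => pr (v.2 i)))
        (volume.withDensity fun v => ENNReal.ofReal (projDens g y πθ ν Q pr v)) =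
      volume.withDensity fun u => ENNReal.ofReal (densS g y πθ f₀ f u) := by
    refine Measure.ext_of_lintegral _ fun F hF => ?_
    have hFP : Measurable fun v : Theta dθ × (Fin (n + 1) → Zsp d) =>
        F (v.1, fun i => pr (v.2 i)) := hF.comp hmP
    rw [lintegral_map hF hmP, lintegral_withDensity_eq_lintegral_mul _ hmL hFP,
      lintegral_withDensity_eq_lintegral_mul _ hmR hF]
    simp only [Pi.mul_apply]
    simpa only [mul_comm] using lintegral_projDens hM hP F hF
  have h := integral_map (μ := volume.withDensity fun v =>
    ENNReal.ofReal (projDens g y πθ ν Q pr v)) hmP.aemeasurable (f := φ) hφ.aestronglyMeasurable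
  rw [hmap, integral_withDensity_eq_integral_toReal_smul hmR (ae_of_all _ fun _ => by simp),
    integral_withDensity_eq_integral_toReal_smul hmL (ae_of_all _ fun _ => by simp)] at h
  have h0L : ∀ v, 0 ≤ projDens g y πθ ν Q pr v := pathDens_nonneg
    (fun p θ z => (hM.g_pos p θ (pr z)).le) hM.prior_nonneg hM.init_nonneg hM.trans_nonneg
  have h0R : ∀ u, 0 ≤ densS g y πθ f₀ f u := pathDens_nonneg
    (fun p θ x => (hM.g_pos p θ x).le) hM.prior_nonneg hP.init_nonneg hP.trans_nonneg
  simp only [ENNReal.toReal_ofReal (h0L _), ENNReal.toReal_ofReal (h0R _), smul_eq_mul] at h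
  simpa only [mul_comm] using h.symm

lemma lintegral_ofReal_eq_one {A : Type*} [MeasurableSpace A] {μ : Measure A} {r : A → ℝ}
    (h0 : ∀ a, 0 ≤ r a) (h1 : ∫ a, r a ∂μ = 1) : ∫⁻ a, ENNReal.ofReal (r a) ∂μ = 1 := by
  rw [← ofReal_integral_eq_lintegral_ofReal (integrable_of_integral_eq_one h1) (ae_of_all _ h0),
    h1, ENNReal.ofReal_one]

lemma IsCoupledModel.lintegral_pathDens_one (hM : IsCoupledModel g y πθ ν Q) :
    ∫⁻ v, ENNReal.ofReal (pathDens (n := n) (fun _ _ _ => 1) πθ ν Q v) = 1 := by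
  have hm := measurable_pathDens (n := n) (γ := fun _ _ _ => 1) (fun _ => measurable_const)
    hM.measurable_prior hM.measurable_init hM.measurable_trans
  rw [Measure.volume_eq_prod, lintegral_prod _ hm.ennreal_ofReal.aemeasurable]
  have hθ : ∀ θ, ∫⁻ z, ENNReal.ofReal (pathDens (n := n) (fun _ _ _ => 1) πθ ν Q (θ, z)) =
      ENNReal.ofReal (πθ θ) := by
    intro θ
    have key := lintegral_chainDens_proj (volume : Measure (Zsp d)) (Measure.dirac ())
      (pr := fun _ => ()) measurable_const
      (measurable_of_param hM.measurable_init θ) (f₀ := fun _ => 1) measurable_const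
      (measurable_uncurry_of_param hM.measurable_trans θ) (f := fun _ _ => 1) measurable_const
      (fun ψ _ => by
        rw [lintegral_const_mul _ (measurable_of_param hM.measurable_init θ),
          lintegral_ofReal_eq_one (hM.init_nonneg θ) (hM.integral_init θ)]
        simp)
      (fun ψ _ z => by
        have hQz : Measurable fun z' => ENNReal.ofReal (Q θ z z') :=
          (measurable_uncurry_of_param hM.measurable_trans θ).comp
            (measurable_prodMk_left (x := z))
        rw [lintegral_const_mul _ hQz,
          lintegral_ofReal_eq_one (hM.trans_nonneg θ z) (hM.integral_trans θ z)]
        simp) n (fun _ => ENNReal.ofReal (πθ θ)) measurable_const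
    simp only [ofReal_pathDens (fun _ _ (_ : Zsp d) => zero_le_one) hM.prior_nonneg
      hM.init_nonneg hM.trans_nonneg, ENNReal.ofReal_one, Finset.prod_const_one, mul_one]
    refine key.trans ?_
    simp [chainDens]
  simp only [hθ]
  exact lintegral_ofReal_eq_one hM.prior_nonneg hM.integral_prior

lemma IsCoupledModel.Znorm_pos (hM : IsCoupledModel g y πθ ν Q) : 0 < Znorm g y πθ ν Q := by
  choose lo hi hlo hlohi hb using hM.g_bounds
  have hm1 := measurable_pathDens (n := n) (γ := fun _ _ _ => 1) (fun _ => measurable_const)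
    hM.measurable_prior hM.measurable_init hM.measurable_trans
  have h10 := pathDens_nonneg (n := n) (γ := fun _ _ _ => 1) (fun _ _ _ => zero_le_one)
    hM.prior_nonneg hM.init_nonneg hM.trans_nonneg
  have hi1 : Integrable (pathDens (n := n) (fun _ _ _ => 1) πθ ν Q) := by
    refine (lintegral_ofReal_ne_top_iff_integrable hm1.aestronglyMeasurable
      (ae_of_all _ h10)).1 ?_
    rw [hM.lintegral_pathDens_one]
    exact ENNReal.one_ne_top
  have hint1 : ∫ v, pathDens (n := n) (fun _ _ _ => 1) πθ ν Q v = 1 := by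
    rw [integral_eq_lintegral_of_nonneg_ae (ae_of_all _ h10) hm1.aestronglyMeasurable,
      hM.lintegral_pathDens_one, ENNReal.toReal_one]
  have hfac : ∀ v, densC g y πθ ν Q v =
      (∏ p, Gmax g y v.1 p (v.2 p.succ)) * pathDens (n := n) (fun _ _ _ => 1) πθ ν Q v := by
    intro v
    simp only [densC, pathDens, Finset.prod_mul_distrib, one_mul]
    ring
  have hGlo : ∀ p θ z, lo p ≤ Gmax g y θ p z := fun p θ z =>
    (hb p θ z.1).1.trans (le_max_left _ _)
  have hGhi : ∀ p θ z, Gmax g y θ p z ≤ hi p := fun p θ z =>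
    max_le (hb p θ z.1).2 (hb p θ z.2).2
  have hlower : ∀ v, (∏ p, lo p) * pathDens (n := n) (fun _ _ _ => 1) πθ ν Q v ≤
      densC g y πθ ν Q v := fun v => by
    rw [hfac]
    exact mul_le_mul_of_nonneg_right
      (Finset.prod_le_prod (fun p _ => (hlo p).le) fun p _ => hGlo _ _ _) (h10 v)
  have hupper : ∀ v, densC g y πθ ν Q v ≤
      (∏ p, hi p) * pathDens (n := n) (fun _ _ _ => 1) πθ ν Q v := fun v => by
    rw [hfac]
    exact mul_le_mul_of_nonneg_right
      (Finset.prod_le_prod (fun p _ => (hlo p).le.trans (hGlo _ _ _)) fun p _ => hGhi _ _ _)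
      (h10 v)
  have hlo0 : 0 < ∏ p, lo p := Finset.prod_pos fun p _ => hlo p
  have hmC := measurable_densC hM
  have hiC : Integrable (densC g y πθ ν Q) := by
    refine (hi1.const_mul (∏ p, hi p)).mono' hmC.aestronglyMeasurable (ae_of_all _ fun v => ?_)
    rw [Real.norm_of_nonneg ((mul_nonneg hlo0.le (h10 v)).trans (hlower v))]
    exact hupper v
  refine hlo0.trans_le ?_
  have h := integral_mono (hi1.const_mul (∏ p, lo p)) hiC hlower
  rwa [integral_const_mul, hint1, mul_one] at h

/-- Integration against a nonnegative normalized density. -/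
lemma integral_withDensity_ofReal_div {A : Type*} [MeasurableSpace A] {μ : Measure A}
    {D : A → ℝ} (hD : Measurable D) (hD0 : ∀ a, 0 ≤ D a) {c : ℝ} (hc : 0 ≤ c) (φ : A → ℝ) :
    ∫ a, φ a ∂(μ.withDensity fun a => ENNReal.ofReal (D a / c)) = (∫ a, φ a * D a ∂μ) / c := by
  rw [integral_withDensity_eq_integral_toReal_smul (hD.div_const c).ennreal_ofReal
    (ae_of_all _ fun _ => by simp), ← integral_div]
  refine integral_congr_ae (ae_of_all _ fun a => ?_)
  simp only [ENNReal.toReal_ofReal (div_nonneg (hD0 a) hc), smul_eq_mul]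
  ring

/-- The self-normalized importance-sampling identity along a marginal projection. -/
lemma importance_ratio (hM : IsCoupledModel g y πθ ν Q) (hP : IsMarginal pr ν Q f₀ f)
    {φ : Theta dθ × (Fin (n + 1) → Xsp d) → ℝ} (hφ : Measurable φ) :
    (∫ v, φ (v.1, fun p => pr (v.2 p)) *
        (∏ p : Fin n, g v.1 (pr (v.2 p.succ)) (y p) / Gmax g y v.1 p (v.2 p.succ))
          ∂(piCoup g y πθ ν Q)) /
      (∫ v, ∏ p : Fin n, g v.1 (pr (v.2 p.succ)) (y p) / Gmax g y v.1 p (v.2 p.succ)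
          ∂(piCoup g y πθ ν Q)) =
      ∫ u, φ u ∂(piSingle g y πθ f₀ f) := by
  have hZ := hM.Znorm_pos
  have hG : ∀ p θ z, 0 < Gmax g y θ p z := fun p θ z =>
    (hM.g_pos p θ z.1).trans_le (le_max_left _ _)
  have hmC := measurable_densC hM
  have hC0 : ∀ v, 0 ≤ densC g y πθ ν Q v := pathDens_nonneg
    (fun p θ z => (hG p θ z).le) hM.prior_nonneg hM.init_nonneg hM.trans_nonneg
  have hS0 : ∀ u, 0 ≤ densS g y πθ f₀ f u := pathDens_nonneg
    (fun p θ x => (hM.g_pos p θ x).le) hM.prior_nonneg hP.init_nonneg hP.trans_nonneg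
  have hweight : ∀ v : Theta dθ × (Fin (n + 1) → Zsp d),
      (∏ p : Fin n, g v.1 (pr (v.2 p.succ)) (y p) / Gmax g y v.1 p (v.2 p.succ)) *
        densC g y πθ ν Q v = projDens g y πθ ν Q pr v := by
    intro v
    have hne : ∏ p : Fin n, Gmax g y v.1 p (v.2 p.succ) ≠ 0 :=
      Finset.prod_ne_zero_iff.2 fun p _ => (hG _ _ _).ne'
    simp only [densC, projDens, pathDens, Finset.prod_mul_distrib, Finset.prod_div_distrib]
    field_simp
  have hnum := integral_projDens hM hP hφ
  have hden := integral_projDens hM hP (φ := fun _ => 1) measurable_const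
  simp only [one_mul] at hden
  unfold piCoup piSingle
  rw [integral_withDensity_ofReal_div hmC hC0 hZ.le, integral_withDensity_ofReal_div hmC hC0 hZ.le,
    integral_withDensity_ofReal_div (measurable_densS hM hP) hS0 (integral_nonneg hS0)]
  simp only [mul_assoc, hweight]
  rw [hnum, hden, div_div_div_cancel_right₀ hZ.ne']

end Model

/-- if `g` is bounded above and below as in (A1), `Q` is a coupling of
the level-`h` and level-`h'` transition densities `f_{θ,h}, f_{θ,h'}`, and `ν_θ` is a
coupling of the initial density `f_θ` with itself, then for every bounded measurable
`φ : Θ × X^{n+1} → ℝ` the two self-normalized importance-sampling ratios recover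
`E_{π_h}[φ]` and `E_{π_{h'}}[φ]`, and consequently
`E_{π_h}[φ] − E_{π_{h'}}[φ]` equals their difference. -/
theorem statement4 {dθ d m n : ℕ} (hn : 1 ≤ n)
    (y : Fin n → Ysp m) (g : Theta dθ → Xsp d → Ysp m → ℝ)
    (πθ : Theta dθ → ℝ) (ν : Theta dθ → Zsp d → ℝ)
    (Q : Theta dθ → Zsp d → Zsp d → ℝ)
    (f0 : Theta dθ → Xsp d → ℝ)
    (fh fh' : Theta dθ → Xsp d → Xsp d → ℝ)
    (hg_meas : Measurable fun p : (Theta dθ × Xsp d) × Ysp m => g p.1.1 p.1.2 p.2)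
    (hπθ_meas : Measurable πθ) (hπθ_nonneg : ∀ θ, 0 ≤ πθ θ)
    (hπθ_int : ∫ θ, πθ θ = 1)
    (hν_meas : Measurable fun p : Theta dθ × Zsp d => ν p.1 p.2)
    (hν_nonneg : ∀ θ z, 0 ≤ ν θ z) (hν_int : ∀ θ, ∫ z, ν θ z = 1)
    (hQ_meas : Measurable fun p : Theta dθ × Zsp d × Zsp d => Q p.1 p.2.1 p.2.2)
    (hQ_nonneg : ∀ θ z z', 0 ≤ Q θ z z')
    (hQ_int : ∀ θ z, ∫ z', Q θ z z' = 1)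
    (hf0_meas : Measurable fun p : Theta dθ × Xsp d => f0 p.1 p.2)
    (hf0_nonneg : ∀ θ x, 0 ≤ f0 θ x) (hf0_int : ∀ θ, ∫ x, f0 θ x = 1)
    (hfh_meas : Measurable fun p : Theta dθ × Xsp d × Xsp d => fh p.1 p.2.1 p.2.2)
    (hfh'_meas : Measurable fun p : Theta dθ × Xsp d × Xsp d => fh' p.1 p.2.1 p.2.2)
    (hfh_nonneg : ∀ θ x x', 0 ≤ fh θ x x') (hfh'_nonneg : ∀ θ x x', 0 ≤ fh' θ x x')
    -- (A1): uniform bounds on the observation density.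
    (hA1 : ∀ yv : Ysp m, ∃ Clo Chi : ℝ, 0 < Clo ∧ Clo ≤ Chi ∧
      ∀ (θ : Theta dθ) (x : Xsp d), Clo ≤ g θ x yv ∧ g θ x yv ≤ Chi)
    -- `Q_{θ,h,h'}` is a coupling of the transition densities `f_{θ,h}` and `f_{θ,h'}`.
    (hQ_marg1 : ∀ (θ : Theta dθ) (x x' xb : Xsp d),
      ∫ xb', Q θ (x, x') (xb, xb') = fh θ x xb)
    (hQ_marg2 : ∀ (θ : Theta dθ) (x x' xb' : Xsp d),
      ∫ xb, Q θ (x, x') (xb, xb') = fh' θ x' xb')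
    -- `ν_θ` is a coupling of the initial density `f_θ` with itself.
    (hν_marg1 : ∀ (θ : Theta dθ) (x0 : Xsp d), ∫ x0', ν θ (x0, x0') = f0 θ x0)
    (hν_marg2 : ∀ (θ : Theta dθ) (x0' : Xsp d), ∫ x0, ν θ (x0, x0') = f0 θ x0')
    (φ : Theta dθ × (Fin (n + 1) → Xsp d) → ℝ)
    (hφ_meas : Measurable φ) (hφ_bdd : ∃ B : ℝ, ∀ u, |φ u| ≤ B) :
    ((∫ v, φ (v.1, fun p => (v.2 p).1) * H1 g y v.1 v.2 ∂(piCoup g y πθ ν Q)) /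
        (∫ v, H1 g y v.1 v.2 ∂(piCoup g y πθ ν Q))
      = ∫ u, φ u ∂(piSingle g y πθ f0 fh)) ∧
    ((∫ v, φ (v.1, fun p => (v.2 p).2) * H2 g y v.1 v.2 ∂(piCoup g y πθ ν Q)) /
        (∫ v, H2 g y v.1 v.2 ∂(piCoup g y πθ ν Q))
      = ∫ u, φ u ∂(piSingle g y πθ f0 fh')) ∧
    ((∫ u, φ u ∂(piSingle g y πθ f0 fh)) - ∫ u, φ u ∂(piSingle g y πθ f0 fh')
      = (∫ v, φ (v.1, fun p => (v.2 p).1) * H1 g y v.1 v.2 ∂(piCoup g y πθ ν Q)) /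
          (∫ v, H1 g y v.1 v.2 ∂(piCoup g y πθ ν Q)) -
        (∫ v, φ (v.1, fun p => (v.2 p).2) * H2 g y v.1 v.2 ∂(piCoup g y πθ ν Q)) /
          (∫ v, H2 g y v.1 v.2 ∂(piCoup g y πθ ν Q))) := by
  have hM : IsCoupledModel g y πθ ν Q :=
    { measurable_g := fun p => by
        have h : Measurable fun u : Theta dθ × Xsp d => (u, y p) := by fun_prop
        exact hg_meas.comp h
      g_bounds := fun p => hA1 (y p)
      measurable_prior := hπθ_meas
      prior_nonneg := hπθ_nonneg
      integral_prior := hπθ_int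
      measurable_init := hν_meas
      init_nonneg := hν_nonneg
      integral_init := hν_int
      measurable_trans := hQ_meas
      trans_nonneg := hQ_nonneg
      integral_trans := hQ_int }
  have hνθ : ∀ θ, Measurable (ν θ) := fun θ => hν_meas.comp measurable_prodMk_left
  have hQθ : ∀ θ z, Measurable (Q θ z) := fun θ z =>
    hQ_meas.comp (measurable_prodMk_left.comp measurable_prodMk_left)
  have hP1 : IsMarginal Prod.fst ν Q f0 fh :=
    { measurable_pr := measurable_fst
      measurable_init := hf0_meas
      init_nonneg := hf0_nonneg
      measurable_trans := hfh_meas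
      trans_nonneg := hfh_nonneg
      lintegral_init := fun θ => lintegral_fst_mul_ofReal volume volume (hνθ θ) (hν_nonneg θ)
        (integrable_of_integral_eq_one (hν_int θ)) (hν_marg1 θ)
      lintegral_trans := fun θ ψ hψ z =>
        lintegral_fst_mul_ofReal volume volume (hQθ θ z) (hQ_nonneg θ z)
          (integrable_of_integral_eq_one (hQ_int θ z)) (hQ_marg1 θ z.1 z.2) ψ hψ }
  have hP2 : IsMarginal Prod.snd ν Q f0 fh' :=
    { measurable_pr := measurable_snd
      measurable_init := hf0_meas
      init_nonneg := hf0_nonneg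
      measurable_trans := hfh'_meas
      trans_nonneg := hfh'_nonneg
      lintegral_init := fun θ => lintegral_snd_mul_ofReal volume volume (hνθ θ) (hν_nonneg θ)
        (integrable_of_integral_eq_one (hν_int θ)) (hν_marg2 θ)
      lintegral_trans := fun θ ψ hψ z =>
        lintegral_snd_mul_ofReal volume volume (hQθ θ z) (hQ_nonneg θ z)
          (integrable_of_integral_eq_one (hQ_int θ z)) (hQ_marg2 θ z.1 z.2) ψ hψ }
  have h1 := importance_ratio hM hP1 hφ_meas
  have h2 := importance_ratio hM hP2 hφ_meas
  exact ⟨h1, h2, (congrArg₂ (· - ·) h1 h2).symm⟩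

end
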